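/- arXiv:2012.01928 — 2 statements merged into one kernel-verified Lean document; each statement's English description precedes it below -/
import Mathlib

section
/- Let M ∈ ℝ^{m×m} be column stochastic, S ⊆ {1,…,m} nonempty, M_S the S-absorbing modification, T = {1,…,m} \ S, and let Q be the submatrix of M_S with rows and columns indexed by T (so Q[j,i] = M[j,i] for i, j ∈ T). If for every j ∈ T there exist n ≥ 1 and i ∈ S with (M_S^n)[i,j] > 0 (every non-absorbing state reaches the absorbing set with positive probability), then the spectral radius of Q satisfies ρ(Q) < 1. -/
open Finset Matrix

/-- The `S`-absorbing modification of a matrix `M` (entry `j i` is the transition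
probability from bin `i` to bin `j`): columns indexed by `i ∈ S` are replaced by the
standard basis vector `e_i`, other columns are unchanged. -/
def absorbing {m : ℕ} (M : Matrix (Fin m) (Fin m) ℝ) (S : Finset (Fin m)) :
    Matrix (Fin m) (Fin m) ℝ :=
  fun j i => if i ∈ S then (if j = i then 1 else 0) else M j i

/-- If every non-absorbing state reaches the absorbing set `S` with positive probability
under the `S`-absorbing modification `M_S`, then the substochastic submatrix `Q` of `M_S`
on the non-absorbing states `T = Sᶜ` has spectral radius `ρ(Q) < 1` (spectral radius taken
as the maximum modulus of the complex eigenvalues). -/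
theorem absorbing_submatrix_spectralRadius_lt_one {m : ℕ}
    (M : Matrix (Fin m) (Fin m) ℝ) (S : Finset (Fin m)) (hS : S.Nonempty)
    (hM0 : ∀ j i, 0 ≤ M j i) (hM1 : ∀ i, ∑ j, M j i = 1)
    (Q : Matrix {i : Fin m // i ∉ S} {i : Fin m // i ∉ S} ℝ)
    (hQ : ∀ j i, Q j i = M j.val i.val)
    (hreach : ∀ j : Fin m, j ∉ S → ∃ n ≥ 1, ∃ i ∈ S, 0 < ((absorbing M S) ^ n) i j) :
    spectralRadius ℂ (Q.map (algebraMap ℝ ℂ)) < 1 := by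
  classical
  have key : ∀ μ ∈ spectrum ℂ (Q.map (algebraMap ℝ ℂ)), ‖μ‖ < 1 := by
    intro μ hμ
    by_contra hlt
    push Not at hlt
    rw [spectrum.mem_iff, Matrix.isUnit_iff_isUnit_det, isUnit_iff_ne_zero, not_not] at hμ
    obtain ⟨v, hv0, hv⟩ := Matrix.exists_vecMul_eq_zero_iff.mpr hμ
    have hv' : ∀ i, μ * v i = ∑ j, v j * (Q j i : ℂ) := by
      intro i
      have h := congrFun hv i
      rw [Matrix.vecMul_sub, Algebra.algebraMap_eq_smul_one, Matrix.vecMul_smul,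
        Matrix.vecMul_one] at h
      simp only [Pi.sub_apply, Pi.smul_apply, smul_eq_mul, Pi.zero_apply, sub_eq_zero] at h
      rw [h]
      simp [Matrix.vecMul, dotProduct]
    obtain ⟨k, hk⟩ := Function.ne_iff.mp hv0
    let w : Fin m → ℝ := fun j => if h : j ∉ S then ‖v ⟨j, h⟩‖ else 0
    have hwS : ∀ j ∈ S, w j = 0 := fun j hj => by simp [w, hj]
    have hwT : ∀ j : {i : Fin m // i ∉ S}, w j = ‖v j‖ := fun j => by simp [w, j.2]
    obtain ⟨a, -, ha⟩ := Finset.exists_max_image Finset.univ w ⟨k.1, Finset.mem_univ _⟩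
    have hc : 0 < w a := by
      refine lt_of_lt_of_le ?_ (ha k.1 (Finset.mem_univ _))
      rw [hwT]
      exact norm_pos_iff.mpr hk
    have hsub : ∀ i, i ∉ S → w i ≤ ∑ j, w j * M j i := by
      intro i hi
      have h1 : ∑ j, w j * M j i = ∑ j : {i : Fin m // i ∉ S}, w j * M j i := by
        rw [← Finset.sum_subtype Sᶜ (by simp) (fun j => w j * M j i)]
        symm
        refine Finset.sum_subset (Finset.subset_univ _) fun j _ hj => ?_
        rw [hwS j (by simpa using hj), zero_mul]
      rw [h1, hwT ⟨i, hi⟩]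
      calc ‖v ⟨i, hi⟩‖ ≤ ‖μ‖ * ‖v ⟨i, hi⟩‖ := le_mul_of_one_le_left (norm_nonneg _) hlt
        _ = ‖∑ j, v j * (Q j ⟨i, hi⟩ : ℂ)‖ := by rw [← hv', norm_mul]
        _ ≤ ∑ j, ‖v j * (Q j ⟨i, hi⟩ : ℂ)‖ := norm_sum_le _ _
        _ = _ := by
          refine Finset.sum_congr rfl fun j _ => ?_
          rw [norm_mul, hwT, hQ, Complex.norm_real, Real.norm_of_nonneg (hM0 _ _)]
    have hclosed : ∀ i, w i = w a → ∀ j, w j ≠ w a → M j i = 0 := by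
      intro i hi j hj
      have hiS : i ∉ S := fun h => by rw [hwS i h] at hi; exact hc.ne hi
      have hnn : ∀ j ∈ Finset.univ, 0 ≤ (w a - w j) * M j i := fun j hj =>
        mul_nonneg (sub_nonneg.mpr (ha j hj)) (hM0 _ _)
      have hz : ∑ j, (w a - w j) * M j i = 0 := by
        refine le_antisymm ?_ (Finset.sum_nonneg hnn)
        have := hsub i hiS
        simp only [sub_mul, Finset.sum_sub_distrib, ← Finset.mul_sum, hM1]
        linarith
      have := (Finset.sum_eq_zero_iff_of_nonneg hnn).mp hz j (Finset.mem_univ _)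
      rcases mul_eq_zero.mp this with h | h
      · exact absurd (sub_eq_zero.mp h).symm hj
      · exact h
    have hpow : ∀ n : ℕ, ∀ i, w i = w a → ∀ j, w j ≠ w a → ((absorbing M S) ^ n) j i = 0 := by
      intro n
      induction n with
      | zero =>
        intro i hi j hj
        rw [pow_zero, Matrix.one_apply_ne]
        rintro rfl
        exact hj hi
      | succ n ih =>
        intro i hi j hj
        have hiS : i ∉ S := fun h => by rw [hwS i h] at hi; exact hc.ne hi
        rw [pow_succ, Matrix.mul_apply]
        refine Finset.sum_eq_zero fun l _ => ?_
        by_cases hl : w l = w a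
        · rw [ih l hl j hj, zero_mul]
        · have : absorbing M S l i = 0 := by
            simp only [absorbing, hiS, if_false]
            exact hclosed i hi l hl
          rw [this, mul_zero]
    have haS : a ∉ S := fun h => hc.ne' (hwS a h)
    obtain ⟨n, -, i, hi, hpos⟩ := hreach a haS
    exact hpos.ne' (hpow n a rfl i (by rw [hwS i hi]; exact hc.ne))
  have hfin : (spectrum ℂ (Q.map (algebraMap ℝ ℂ))).Finite := Matrix.finite_spectrum _
  unfold spectralRadius
  have : (⨆ k ∈ spectrum ℂ (Q.map (algebraMap ℝ ℂ)), (‖k‖₊ : ENNReal))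
      = hfin.toFinset.sup (fun k => (‖k‖₊ : ENNReal)) := by
    rw [Finset.sup_eq_iSup]; simp
  rw [this, Finset.sup_lt_iff (by simp)]
  intro k hk
  have := key k (by simpa using hk)
  exact_mod_cast this
end

section
/- (Deterministic mean-field version of the paper's Theorem 1.) Let M ∈ ℝ^{m×m} be column stochastic, S ⊆ {1,…,m} nonempty, M_S the S-absorbing modification, T = {1,…,m} \ S, and Q the submatrix of M_S on T×T with ρ(Q) < 1. Let x ∈ ℝ^m be a probability vector with x[i] = 0 for all i ∈ S, let N_r > 0, and let ŝ_r = N_r · lim_{n→∞} M_S^n x be the elimination-free absorbed red counts on S. Let b ∈ ℝ^m be a nonnegative blue count vector supported on S (b[i] = 0 for i ∉ S). Define the engagement dynamics: z_r(0) = N_r x, z_b(0) = b, and for k ≥ 0, z_r(k+1) = max(M_S z_r(k) − z_b(k), 0), z_b(k+1) = max(z_b(k) − M_S z_r(k), 0) (componentwise; the blue swarm holds position on S with the identity policy while the red swarm propagates by M_S, and co-located agents eliminate each other in equal numbers). Then the surviving red population satisfies limsup_{k→∞} 𝟙ᵀ z_r(k) ≤ 𝟙ᵀ max(ŝ_r −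 b, 0) = L̂_r. In particular, the number of red agents that can pass the boundary bins S toward the base location is at most L̂_r. -/
open Finset Matrix Filter Topology

/-- Deterministic mean-field version of the paper's Theorem 1: if the blue swarm holds the
boundary bins `S` with count vector `b` while the red swarm propagates by the `S`-absorbing
chain `M_S` from an initial density `x` supported off `S`, with eliminations in equal
numbers in shared bins, then the surviving red population is eventually bounded by
`L̂_r = 𝟙ᵀ max(ŝ_r − b, 0)`, where `ŝ_r = N_r · lim M_S^n x` are the elimination-free
absorbed red counts on `S`. -/
theorem red_survivors_le_Lhat {m : ℕ}
    (M : Matrix (Fin m) (Fin m) ℝ) (S : Finset (Fin m)) (hS : S.Nonempty)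
    (hM0 : ∀ j i, 0 ≤ M j i) (hM1 : ∀ i, ∑ j, M j i = 1)
    (Q : Matrix {i : Fin m // i ∉ S} {i : Fin m // i ∉ S} ℝ)
    (hQ : ∀ j i, Q j i = M j.val i.val)
    (hρ : spectralRadius ℂ (Q.map (algebraMap ℝ ℂ)) < 1)
    (x : Fin m → ℝ) (hx0 : ∀ i, 0 ≤ x i) (hx1 : ∑ i, x i = 1)
    (hxS : ∀ i ∈ S, x i = 0)
    (Nr : ℝ) (hNr : 0 < Nr)
    (xhat : Fin m → ℝ)
    (hlim : Tendsto (fun n : ℕ => ((absorbing M S) ^ n).mulVec x) atTop (𝓝 xhat))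
    (b : Fin m → ℝ) (hb0 : ∀ i, 0 ≤ b i) (hbS : ∀ i ∉ S, b i = 0)
    (zr zb : ℕ → Fin m → ℝ)
    (hzr0 : zr 0 = fun i => Nr * x i) (hzb0 : zb 0 = b)
    (hzr : ∀ k i, zr (k + 1) i = max ((absorbing M S).mulVec (zr k) i - zb k i) 0)
    (hzb : ∀ k i, zb (k + 1) i = max (zb k i - (absorbing M S).mulVec (zr k) i) 0) :
    Filter.limsup (fun k => ∑ i, zr k i) atTop ≤ ∑ i, max (Nr * xhat i - b i) 0 := by
  have hA0 : ∀ j i, 0 ≤ absorbing M S j i := by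
    intro j i
    unfold _root_.absorbing
    split_ifs
    · exact zero_le_one
    · exact le_rfl
    · exact hM0 j i
  have hy0 : ∀ n i, 0 ≤ ((absorbing M S) ^ n).mulVec x i := by
    intro n
    induction n with
    | zero => intro i; simpa using hx0 i
    | succ n ih =>
      intro i
      rw [pow_succ', ← Matrix.mulVec_mulVec]
      simp only [Matrix.mulVec, dotProduct] at ih ⊢
      exact Finset.sum_nonneg fun j _ => mul_nonneg (hA0 i j) (ih j)
  have key : ∀ k, (∀ i, zr k i = max (Nr * ((absorbing M S) ^ k).mulVec x i - b i) 0) ∧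
      (∀ i, zb k i = max (b i - Nr * ((absorbing M S) ^ k).mulVec x i) 0) := by
    intro k
    induction k with
    | zero =>
      constructor
      · intro i
        simp only [hzr0, pow_zero, Matrix.one_mulVec]
        by_cases hi : i ∈ S
        · rw [hxS i hi, max_eq_right] <;> simp [hb0 i]
        · rw [hbS i hi, sub_zero, max_eq_left (mul_nonneg hNr.le (hx0 i))]
      · intro i
        simp only [hzb0, pow_zero, Matrix.one_mulVec]
        by_cases hi : i ∈ S
        · rw [hxS i hi, mul_zero, sub_zero, max_eq_left (hb0 i)]
        · rw [hbS i hi, max_eq_right]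
          have := mul_nonneg hNr.le (hx0 i)
          linarith
    | succ k ih =>
      obtain ⟨ih1, ih2⟩ := ih
      have hoff : ∀ i ∉ S, zr k i = Nr * ((absorbing M S) ^ k).mulVec x i := by
        intro i hi
        rw [ih1, hbS i hi, sub_zero, max_eq_left (mul_nonneg hNr.le (hy0 k i))]
      have hdiff : ∀ i, zr k i - zb k i = Nr * ((absorbing M S) ^ k).mulVec x i - b i := by
        intro i
        rw [ih1, ih2]
        rcases le_total (Nr * ((absorbing M S) ^ k).mulVec x i) (b i) with h | h
        · rw [max_eq_right (by linarith), max_eq_left (by linarith)]; ring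
        · rw [max_eq_left (by linarith), max_eq_right (by linarith)]; ring
      have hstep : ∀ i, (absorbing M S).mulVec (zr k) i =
          Nr * ((absorbing M S) ^ (k + 1)).mulVec x i +
            (zr k i - Nr * ((absorbing M S) ^ k).mulVec x i) := by
        intro i
        rw [pow_succ', ← Matrix.mulVec_mulVec]
        generalize ((absorbing M S) ^ k).mulVec x = y at hoff
        have h1 : ∑ j, absorbing M S i j * (zr k j - Nr * y j) = zr k i - Nr * y i := by
          have h2 : ∀ j, absorbing M S i j * (zr k j - Nr * y j) =
              if i = j then zr k j - Nr * y j else 0 := by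
            intro j
            by_cases hj : j ∈ S
            · by_cases hij : i = j <;> simp [_root_.absorbing, hj, hij]
            · simp [hoff j hj]
          simp [h2]
        rw [← h1]
        simp only [Matrix.mulVec, dotProduct, Finset.mul_sum, ← Finset.sum_add_distrib]
        exact Finset.sum_congr rfl fun j _ => by ring
      constructor
      · intro i
        rw [hzr, hstep]
        congr 1
        linarith [hdiff i]
      · intro i
        rw [hzb, hstep]
        congr 1
        linarith [hdiff i]
  have hT : Tendsto (fun k => ∑ i, zr k i) atTop (𝓝 (∑ i, max (Nr * xhat i - b i) 0)) := by
    refine tendsto_finsetSum _ fun i _ => ?_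
    simp only [fun k => (key k).1 i]
    exact (((tendsto_pi_nhds.1 hlim i).const_mul Nr).sub_const (b i)).max tendsto_const_nhds
  exact hT.limsup_eq.le
end
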